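/- arXiv:2304.08846 — 5 statements merged into one kernel-verified Lean document; each statement's English description precedes it below -/
import Mathlib

section
/- Let e be an edge of a connected graph G such that G − e is still connected. Then λ₁(D(G)) < λ₁(D(G − e)), i.e., deleting the edge e strictly increases the distance spectral radius. -/
/-- The disjoint union `G ∪ H` of two simple graphs (on the sum of the vertex types). -/
def graphDisjUnion {α β : Type*} (G : SimpleGraph α) (H : SimpleGraph β) :
    SimpleGraph (α ⊕ β) :=
  SimpleGraph.fromRel (Sum.LiftRel G.Adj H.Adj)

/-- The join `G ∨ H` of two simple graphs: the disjoint union together with all edges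
between the two parts. -/
def graphJoin {α β : Type*} (G : SimpleGraph α) (H : SimpleGraph β) :
    SimpleGraph (α ⊕ β) :=
  SimpleGraph.fromRel (fun u v => Sum.LiftRel G.Adj H.Adj u v ∨ (u.isLeft ∧ v.isRight))

/-- The distance matrix of a graph: the `(u,v)` entry is the graph distance `d_G(u,v)`. -/
noncomputable def distMatrix {V : Type*} [Fintype V] (G : SimpleGraph V) :
    Matrix V V ℝ :=
  Matrix.of fun u v => (G.dist u v : ℝ)

/-- The distance spectral radius `λ₁(D(G))`: the largest eigenvalue of the distance
matrix of `G` (for a connected graph the distance matrix is symmetric nonnegative, so this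
is the largest element of its real spectrum). -/
noncomputable def distSpecRad {V : Type*} [Fintype V] [DecidableEq V]
    (G : SimpleGraph V) : ℝ :=
  sSup (spectrum ℝ (distMatrix G))

/-- `G` has a spanning `k`-tree: a spanning subgraph which is a tree of maximum degree
at most `k`. -/
def HasSpanningKTree {V : Type*} [Fintype V] (G : SimpleGraph V) (k : ℕ) : Prop :=
  ∃ T : SimpleGraph V, T ≤ G ∧ T.IsTree ∧ ∀ v : V, (T.neighborSet v).ncard ≤ k

/-- The Wiener index `W(G) = ∑_{i<j} d_G(v_i, v_j)`, written as half of the full double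
sum of distances. -/
noncomputable def wiener {V : Type*} [Fintype V] (G : SimpleGraph V) : ℝ :=
  (∑ u : V, ∑ v : V, (G.dist u v : ℝ)) / 2

/-- The graph `G* = K₁ ∨ (K_{n-k-1} ∪ kK₁)`. -/
def starGraph (n k : ℕ) : SimpleGraph (Fin 1 ⊕ (Fin (n - k - 1) ⊕ Fin k)) :=
  graphJoin (⊤ : SimpleGraph (Fin 1))
    (graphDisjUnion (⊤ : SimpleGraph (Fin (n - k - 1))) (⊥ : SimpleGraph (Fin k)))

/-- The graph `G♯ = K_{(n-3)/3} ∨ ((2n+3)/3)K₁`. -/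
def sharpGraph (n : ℕ) : SimpleGraph (Fin ((n - 3) / 3) ⊕ Fin ((2 * n + 3) / 3)) :=
  graphJoin (⊤ : SimpleGraph (Fin ((n - 3) / 3))) (⊥ : SimpleGraph (Fin ((2 * n + 3) / 3)))

/-- The graph `G̃ = K_s ∨ (K_{n-(k-1)s-2} ∪ ((k-2)s+2)K₁)`. -/
def tildeGraph (n k s : ℕ) :
    SimpleGraph (Fin s ⊕ (Fin (n - (k - 1) * s - 2) ⊕ Fin ((k - 2) * s + 2))) :=
  graphJoin (⊤ : SimpleGraph (Fin s))
    (graphDisjUnion (⊤ : SimpleGraph (Fin (n - (k - 1) * s - 2)))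
      (⊥ : SimpleGraph (Fin ((k - 2) * s + 2))))

/-- The graph `G' = K_s ∨ (K_{n-s-(t-1)} ∪ (t-1)K₁)`. -/
def primeGraph (n s t : ℕ) :
    SimpleGraph (Fin s ⊕ (Fin (n - s - (t - 1)) ⊕ Fin (t - 1))) :=
  graphJoin (⊤ : SimpleGraph (Fin s))
    (graphDisjUnion (⊤ : SimpleGraph (Fin (n - s - (t - 1)))) (⊥ : SimpleGraph (Fin (t - 1))))

namespace Matrix.IsHermitian

variable {n : Type*} [Fintype n] [DecidableEq n] {A B : Matrix n n ℝ}

/-- The largest eigenvalue of a real symmetric matrix is attained by an eigenvector. -/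
lemma exists_mulVec_eq_sSup_spectrum_smul [Nonempty n] (hA : A.IsHermitian) :
    ∃ x : n → ℝ, x ≠ 0 ∧ A *ᵥ x = sSup (spectrum ℝ A) • x := by
  have hmem : sSup (spectrum ℝ A) ∈ spectrum ℝ A := by
    rw [hA.spectrum_real_eq_range_eigenvalues]
    exact (Set.range_nonempty _).csSup_mem (Set.finite_range _)
  rw [← Matrix.spectrum_toLin', ← Module.End.hasEigenvalue_iff_mem_spectrum] at hmem
  obtain ⟨x, hx⟩ := hmem.exists_hasEigenvector
  exact ⟨x, hx.2, by simpa using hx.apply_eq_smul⟩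

/-- The largest eigenvalue `μ` of a real symmetric matrix `A` makes `μ - A` positive
semidefinite. -/
lemma posSemidef_sSup_spectrum_sub (hA : A.IsHermitian) :
    (algebraMap ℝ (Matrix n n ℝ) (sSup (spectrum ℝ A)) - A).PosSemidef := by
  have hH : (algebraMap ℝ (Matrix n n ℝ) (sSup (spectrum ℝ A)) - A).IsHermitian := by
    refine IsHermitian.sub ?_ hA
    rw [Matrix.algebraMap_eq_diagonal]
    exact Matrix.isHermitian_diagonal _
  rw [hH.posSemidef_iff_eigenvalues_nonneg]
  intro i
  have hi : hH.eigenvalues i ∈ spectrum ℝ (algebraMap ℝ (Matrix n n ℝ) (sSup (spectrum ℝ A)) - A) :=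
    hH.spectrum_real_eq_range_eigenvalues ▸ Set.mem_range_self i
  rw [← spectrum.singleton_sub_eq, Set.singleton_sub] at hi
  obtain ⟨t, ht, hti⟩ := hi
  have hle : t ≤ sSup (spectrum ℝ A) := by
    refine le_csSup ?_ ht
    rw [hA.spectrum_real_eq_range_eigenvalues]
    exact (Set.finite_range _).bddAbove
  simp only [Pi.zero_apply, ← hti]
  exact sub_nonneg.mpr hle

/-- Increasing an entry of a nonnegative symmetric matrix strictly increases its largest
eigenvalue, provided the larger matrix is positive off the diagonal. -/
lemma sSup_spectrum_lt_sSup_spectrum (hA : A.IsHermitian) (hB : B.IsHermitian)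
    (hA₀ : ∀ i j, 0 ≤ A i j) (hAB : ∀ i j, A i j ≤ B i j) (hB₀ : ∀ i j, i ≠ j → 0 < B i j)
    {u v : n} (huv : A u v < B u v) :
    sSup (spectrum ℝ A) < sSup (spectrum ℝ B) := by
  have : Nonempty n := ⟨u⟩
  by_contra! hle
  obtain ⟨x, hx₀, hx⟩ := hA.exists_mulVec_eq_sSup_spectrum_smul
  have hP := hB.posSemidef_sSup_spectrum_sub
  set l := sSup (spectrum ℝ A)
  set m := sSup (spectrum ℝ B)
  set y : n → ℝ := fun i => |x i| with hy
  have hy₀ : ∀ i, 0 ≤ y i := fun i => abs_nonneg _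
  have hxx : x ⬝ᵥ x = y ⬝ᵥ y := by simp [dotProduct, hy]
  have hyy : 0 ≤ y ⬝ᵥ y := Finset.sum_nonneg fun i _ => mul_self_nonneg _
  have quad (M : Matrix n n ℝ) (z : n → ℝ) :
      z ⬝ᵥ M *ᵥ z = ∑ i, ∑ j, M i j * (z i * z j) := by
    simp only [dotProduct, mulVec, Finset.mul_sum]
    exact Finset.sum_congr rfl fun i _ => Finset.sum_congr rfl fun j _ => by ring
  have hxA : x ⬝ᵥ A *ᵥ x = l * (y ⬝ᵥ y) := by rw [hx, dotProduct_smul, hxx, smul_eq_mul]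
  have hxy : x ⬝ᵥ A *ᵥ x ≤ y ⬝ᵥ A *ᵥ y := by
    rw [quad, quad]
    refine Finset.sum_le_sum fun i _ => Finset.sum_le_sum fun j _ =>
      mul_le_mul_of_nonneg_left ?_ (hA₀ i j)
    rw [hy, ← abs_mul]
    exact le_abs_self _
  have hyAB (i j : n) : A i j * (y i * y j) ≤ B i j * (y i * y j) :=
    mul_le_mul_of_nonneg_right (hAB i j) (mul_nonneg (hy₀ i) (hy₀ j))
  have hyAB' : y ⬝ᵥ A *ᵥ y ≤ y ⬝ᵥ B *ᵥ y := by
    rw [quad, quad]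
    exact Finset.sum_le_sum fun i _ => Finset.sum_le_sum fun j _ => hyAB i j
  have hP' : (algebraMap ℝ (Matrix n n ℝ) m - B) *ᵥ y = m • y - B *ᵥ y := by
    rw [sub_mulVec, Algebra.algebraMap_eq_smul_one, smul_mulVec, one_mulVec]
  have hquad : y ⬝ᵥ (algebraMap ℝ (Matrix n n ℝ) m - B) *ᵥ y =
      m * (y ⬝ᵥ y) - y ⬝ᵥ B *ᵥ y := by
    rw [hP', dotProduct_sub, dotProduct_smul, smul_eq_mul]
  have hnonneg := hP.dotProduct_mulVec_nonneg y
  rw [star_trivial, hquad] at hnonneg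
  have hml : m * (y ⬝ᵥ y) ≤ l * (y ⬝ᵥ y) := mul_le_mul_of_nonneg_right hle hyy
  have hBy : B *ᵥ y = m • y := by
    have hzero := (hP.dotProduct_mulVec_zero_iff y).mp
      (by rw [star_trivial, hquad]; linarith)
    rw [hP'] at hzero
    exact (sub_eq_zero.mp hzero).symm
  have eq_zero_of_apply_eq_zero {w : n} (hw : y w = 0) : False := by
    have hsum : ∑ j, B w j * y j = 0 := by
      have := congrFun hBy w
      simpa [mulVec, dotProduct, hw] using this
    have hterm (j : n) : 0 ≤ B w j * y j := mul_nonneg ((hA₀ w j).trans (hAB w j)) (hy₀ j)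
    rw [Finset.sum_eq_zero_iff_of_nonneg fun j _ => hterm j] at hsum
    refine hx₀ (funext fun j => abs_eq_zero.mp ?_)
    by_cases hj : w = j
    · exact hj ▸ hw
    · exact (mul_eq_zero.mp (hsum j (Finset.mem_univ j))).resolve_left (hB₀ w j hj).ne'
  have hyuv : y u * y v = 0 := by
    by_contra hne
    have hpos : 0 < y u * y v := (mul_nonneg (hy₀ u) (hy₀ v)).lt_of_ne' hne
    have : y ⬝ᵥ A *ᵥ y < y ⬝ᵥ B *ᵥ y := by
      rw [quad, quad]
      exact Finset.sum_lt_sum (fun i _ => Finset.sum_le_sum fun j _ => hyAB i j)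
        ⟨u, Finset.mem_univ u, Finset.sum_lt_sum (fun j _ => hyAB u j)
          ⟨v, Finset.mem_univ v, mul_lt_mul_of_pos_right huv hpos⟩⟩
    linarith
  rcases mul_eq_zero.mp hyuv with h | h <;> exact eq_zero_of_apply_eq_zero h

end Matrix.IsHermitian

lemma isHermitian_distMatrix {V : Type*} [Fintype V] (G : SimpleGraph V) :
    (distMatrix G).IsHermitian :=
  Matrix.IsHermitian.ext fun i j => by simp [distMatrix, SimpleGraph.dist_comm]

/-- **Lemma (Statement 3).** If `e = {u,v}` is an edge of a connected graph `G` such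
that `G - e` is still connected, then `λ₁(D(G)) < λ₁(D(G - e))`. -/
theorem distSpecRad_lt_deleteEdge {V : Type*} [Fintype V] [DecidableEq V]
    (G : SimpleGraph V) (hG : G.Connected) (u v : V) (huv : G.Adj u v)
    (hconn : (G.deleteEdges {s(u, v)}).Connected) :
    distSpecRad G < distSpecRad (G.deleteEdges {s(u, v)}) := by
  refine (isHermitian_distMatrix G).sSup_spectrum_lt_sSup_spectrum (isHermitian_distMatrix _)
    (fun i j => Nat.cast_nonneg _)
    (fun i j => Nat.cast_le.mpr ((hconn i j).dist_anti (G.deleteEdges_le _)))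
    (fun i j hij => Nat.cast_pos.mpr (hconn.pos_dist_of_ne hij)) (u := u) (v := v) ?_
  refine Nat.cast_lt.mpr ?_
  rw [SimpleGraph.dist_eq_one_iff_adj.mpr huv]
  exact hconn.one_lt_dist_of_ne_of_not_adj huv.ne (by simp [SimpleGraph.deleteEdges_adj])
end

section
/- Let k ≥ 3 be an integer and let G be a connected graph. If ω(G − S) ≤ (k−2)|S| + 2 for every subset S of V(G), then G admits a spanning k-tree. -/
namespace SimpleGraph

variable {V : Type*} {G H K T : SimpleGraph V}

/-- The graph on the same vertices keeping only the edges of `G` with both ends in `C`. -/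
def within (G : SimpleGraph V) (C : Set V) : SimpleGraph V where
  Adj x y := G.Adj x y ∧ x ∈ C ∧ y ∈ C
  symm := ⟨fun _ _ h => ⟨h.1.symm, h.2.2, h.2.1⟩⟩
  loopless := ⟨fun _ h => G.irrefl h.1⟩

lemma within_adj {C : Set V} {x y : V} : (G.within C).Adj x y ↔ G.Adj x y ∧ x ∈ C ∧ y ∈ C :=
  Iff.rfl

lemma within_le (C : Set V) : G.within C ≤ G := fun _ _ h => h.1

lemma within_anti_compl {S S' : Set V} (h : S ⊆ S') : G.within S'ᶜ ≤ G.within Sᶜ :=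
  fun _ _ hxy => ⟨hxy.1, fun hx => hxy.2.1 (h hx), fun hy => hxy.2.2 (h hy)⟩

lemma Reachable.of_forall_adj_of_mem {C : Set V}
    (hadj : ∀ x ∈ C, ∀ y, H.Adj x y → y ∈ C ∧ K.Reachable x y) {x y : V} (hx : x ∈ C)
    (h : H.Reachable x y) : K.Reachable x y := by
  obtain ⟨p⟩ := h
  induction p with
  | nil => rfl
  | cons e p ih =>
    obtain ⟨h1, h2⟩ := hadj _ hx _ e
    exact h2.trans (ih h1)

lemma Reachable.of_forall_adj (hadj : ∀ x y, H.Adj x y → K.Reachable x y) {x y : V}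
    (h : H.Reachable x y) : K.Reachable x y :=
  Reachable.of_forall_adj_of_mem (C := Set.univ)
    (fun x _ y e => ⟨Set.mem_univ y, hadj x y e⟩) (Set.mem_univ x) h

lemma eq_of_reachable_within {C : Set V} {x y : V} (hx : x ∉ C)
    (h : (G.within C).Reachable x y) : x = y := by
  obtain ⟨p⟩ := h
  cases p with
  | nil => rfl
  | cons e p => exact absurd e.2.1 hx

lemma Reachable.of_sup_edge {u v x y : V} (h : (H ⊔ edge u v).Reachable x y) :
    H.Reachable x y ∨ (H.Reachable x u ∧ H.Reachable v y) ∨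
      (H.Reachable x v ∧ H.Reachable u y) := by
  obtain ⟨p⟩ := h
  induction p with
  | nil => exact .inl .rfl
  | @cons a b c e p ih =>
    rcases e with e | e
    · have := e.reachable
      rcases ih with h | ⟨h, h'⟩ | ⟨h, h'⟩
      · exact .inl (this.trans h)
      · exact .inr (.inl ⟨this.trans h, h'⟩)
      · exact .inr (.inr ⟨this.trans h, h'⟩)
    · rw [edge_adj] at e
      obtain ⟨⟨rfl, rfl⟩ | ⟨rfl, rfl⟩, -⟩ := e
      · rcases ih with h | ⟨h, h'⟩ | ⟨h, h'⟩
        · exact .inr (.inl ⟨.rfl, h⟩)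
        · exact .inr (.inl ⟨.rfl, h'⟩)
        · exact .inl h'
      · rcases ih with h | ⟨h, h'⟩ | ⟨h, h'⟩
        · exact .inr (.inr ⟨.rfl, h⟩)
        · exact .inl h'
        · exact .inr (.inr ⟨.rfl, h'⟩)

lemma sdiff_edge_sup_edge {u v : V} (h : G.Adj u v) : G \ edge u v ⊔ edge u v = G := by
  rw [sdiff_sup_cancel]
  rw [edge_le_iff]
  exact .inr h

lemma IsAcyclic.not_reachable_sdiff_edge {u v : V} (hG : G.IsAcyclic) (h : G.Adj u v) :
    ¬ (G \ edge u v).Reachable u v :=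
  isBridge_iff.1 (isAcyclic_iff_forall_adj_isBridge.1 hG h)

lemma IsAcyclic.induction_sup_edge [Finite V] {P : SimpleGraph V → Prop} (bot : P ⊥)
    (sup_edge : ∀ (H : SimpleGraph V) (u v : V), H.IsAcyclic → ¬ H.Reachable u v → P H →
      P (H ⊔ edge u v)) (hG : G.IsAcyclic) : P G := by
  induction G using WellFoundedLT.induction with
  | ind G ih =>
    by_cases h : G = ⊥
    · exact h ▸ bot
    · obtain ⟨u, v, huv⟩ := ne_bot_iff_exists_adj.1 h
      have hlt : G \ edge u v < G := by
        refine lt_of_le_of_ne sdiff_le fun he => ?_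
        have := he ▸ huv
        simp [edge_adj, huv.ne] at this
      have hac := hG.anti hlt.le
      have := sup_edge _ u v hac (hG.not_reachable_sdiff_edge huv) (ih _ hlt hac)
      rwa [sdiff_edge_sup_edge huv] at this

/-- In the cycle matroid, an independent set may be replaced by any independent subset
of its closure. -/
lemma IsAcyclic.sup_of_reachable [Finite V] {F F' R : SimpleGraph V} (hF : F.IsAcyclic)
    (hF' : ∀ x y, F.Adj x y → F'.Reachable x y) (hdisj : Disjoint F' R)
    (h : (F' ⊔ R).IsAcyclic) : (F ⊔ R).IsAcyclic := by
  have hR : R.IsAcyclic := h.anti le_sup_right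
  revert hdisj h
  refine hR.induction_sup_edge (P := fun R => Disjoint F' R → (F' ⊔ R).IsAcyclic →
    (F ⊔ R).IsAcyclic) ?_ ?_
  · intro _ _
    simpa using hF
  · intro R u v hR huv ih hdisj h
    rw [← sup_assoc] at h ⊢
    rw [isAcyclic_sup_fromEdgeSet_iff] at h
    have huv' : ¬ (F' ⊔ R).Reachable u v := by
      intro hr
      have hne : u ≠ v := by rintro rfl; exact huv .rfl
      rcases h.2 hr with h | h | h
      · exact hne h
      · have : edge u v ≤ F' := (edge_le_iff _).2 (.inr h)
        have h0 := hdisj this le_sup_right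
        have : (edge u v).Adj u v := by simp [edge_adj, hne]
        exact h0 this
      · exact huv h.reachable
    refine (ih (hdisj.mono_right le_sup_left) h.1).sup_edge_of_not_reachable fun hr => huv' ?_
    refine Reachable.of_forall_adj (fun x y e => ?_) hr
    rcases e with e | e
    · exact (hF' x y e).mono le_sup_left
    · exact Adj.reachable (.inr e)

lemma card_connectedComponent_sup_edge [Finite V] {u v : V} (h : ¬ H.Reachable u v) :
    Nat.card (H ⊔ edge u v).ConnectedComponent + 1 = Nat.card H.ConnectedComponent := by
  classical
  have := Fintype.ofFinite H.ConnectedComponent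
  have := Fintype.ofFinite (H ⊔ edge u v).ConnectedComponent
  have huv : (H ⊔ edge u v).Reachable u v :=
    Adj.reachable (.inr (by rw [edge_adj]; exact ⟨.inl ⟨rfl, rfl⟩, fun e => h (e ▸ .rfl)⟩))
  let f : {c : H.ConnectedComponent // c ≠ H.connectedComponentMk v} →
      (H ⊔ edge u v).ConnectedComponent :=
    fun c => c.1.map (Hom.ofLE le_sup_left)
  have hf : Function.Bijective f := by
    constructor
    · rintro ⟨c, hc⟩ ⟨d, hd⟩ hcd
      induction c using ConnectedComponent.ind with | h x =>
      induction d using ConnectedComponent.ind with | h y =>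
      simp only [f, ConnectedComponent.map_mk, Hom.ofLE_apply, ConnectedComponent.eq] at hcd
      simp only [ne_eq, ConnectedComponent.eq] at hc hd
      simp only [Subtype.mk.injEq, ConnectedComponent.eq]
      rcases hcd.of_sup_edge with h | ⟨-, h⟩ | ⟨h, -⟩
      · exact h
      · exact absurd h.symm hd
      · exact absurd h hc
    · intro c
      induction c using ConnectedComponent.ind with | h x =>
      by_cases hx : H.Reachable x v
      · refine ⟨⟨H.connectedComponentMk u, by simpa using h⟩, ?_⟩
        simp only [f, ConnectedComponent.map_mk, Hom.ofLE_apply, ConnectedComponent.eq]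
        exact huv.trans (hx.mono le_sup_left).symm
      · exact ⟨⟨H.connectedComponentMk x, by simpa using hx⟩, rfl⟩
  rw [← Nat.card_congr (Equiv.ofBijective f hf), Nat.card_eq_fintype_card,
    Nat.card_eq_fintype_card, Fintype.card_subtype_compl, Fintype.card_subtype_eq]
  have : 0 < Fintype.card H.ConnectedComponent :=
    Fintype.card_pos_iff.2 ⟨H.connectedComponentMk v⟩
  omega

lemma IsAcyclic.ncard_edgeSet_add_card_connectedComponent [Finite V] (hG : G.IsAcyclic) :
    G.edgeSet.ncard + Nat.card G.ConnectedComponent = Nat.card V := by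
  refine hG.induction_sup_edge
    (P := fun G => G.edgeSet.ncard + Nat.card G.ConnectedComponent = Nat.card V) ?_ ?_
  · rw [edgeSet_bot, Set.ncard_empty, zero_add]
    refine (Nat.card_congr (Equiv.ofBijective (connectedComponentMk ⊥) ⟨?_, ?_⟩)).symm
    · intro x y h
      simpa using h
    · exact Quot.mk_surjective
  · intro H u v hH huv ih
    have hne : u ≠ v := by rintro rfl; exact huv .rfl
    have hmem : s(u, v) ∉ H.edgeSet := fun h => huv (Adj.reachable h)
    rw [edgeSet_sup, edgeSet_edge_of_ne hne, Set.union_singleton,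
      Set.ncard_insert_of_notMem hmem, ← ih,
      ← card_connectedComponent_sup_edge huv]
    omega

lemma IsAcyclic.exists_adj_not_reachable_sdiff_edge {W : Set V} {u v : V} (hH : H.IsAcyclic)
    (hv : v ∉ W) (hr : H.Reachable u v) (hn : ¬ (H.within Wᶜ).Reachable u v) :
    ∃ w ∈ W, ∃ z, H.Adj w z ∧ ¬ (H \ edge w z).Reachable u v := by
  obtain ⟨p, hp⟩ := hr.exists_isPath
  by_contra! hcon
  have hW : ∀ w ∈ p.support, w ∉ W := by
    intro w hw hwW
    rcases Walk.mem_support_iff_exists_mem_edges.1 hw with rfl | ⟨e, he, hwe⟩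
    · exact hv hwW
    · obtain ⟨z, rfl⟩ := Sym2.mem_iff_exists.1 hwe
      have hadj : H.Adj w z := p.edges_subset_edgeSet he
      obtain ⟨q, hq⟩ := (hcon w hwW z hadj).exists_isPath
      have hpq : p = q.mapLe sdiff_le := congrArg Subtype.val ((hH.subsingleton_path u v).elim
        ⟨p, hp⟩ ⟨q.mapLe sdiff_le, (Walk.isPath_mapLe _).2 hq⟩)
      rw [hpq, Walk.edges_mapLe_eq_edges] at he
      have : (H \ edge w z).Adj w z := q.edges_subset_edgeSet he
      simp [edge_adj, hadj.ne] at this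
  refine hn ⟨p.transfer _ fun e he => ?_⟩
  induction e using Sym2.ind with | h x y =>
  exact ⟨p.edges_subset_edgeSet he, hW _ (p.fst_mem_support_of_mem_edges he),
    hW _ (p.snd_mem_support_of_mem_edges he)⟩

/-- Exchanging the edge `wz` of a forest for an edge `uv` whose path contains `wz`. -/
lemma IsAcyclic.exchange_edge {u v w z : V} (hT : T.IsAcyclic) (hHT : H ≤ T) (hwz : H.Adj w z)
    (huv : H.Reachable u v) (hn : ¬ (H \ edge w z).Reachable u v) :
    (T \ edge w z ⊔ edge u v).IsAcyclic ∧
      ((H \ edge w z).Reachable w u ∧ (H \ edge w z).Reachable v z ∨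
        (H \ edge w z).Reachable w v ∧ (H \ edge w z).Reachable u z) := by
  have hle : H \ edge w z ≤ T \ edge w z := sdiff_le_sdiff_right hHT
  have key : (H \ edge w z).Reachable w u ∧ (H \ edge w z).Reachable v z ∨
        (H \ edge w z).Reachable w v ∧ (H \ edge w z).Reachable u z := by
    rw [← sdiff_edge_sup_edge hwz] at huv
    rcases huv.of_sup_edge with h | ⟨h, h'⟩ | ⟨h, h'⟩
    · exact absurd h hn
    · exact .inl ⟨h.symm, h'.symm⟩
    · exact .inr ⟨h', h⟩
  refine ⟨(hT.anti sdiff_le).sup_edge_of_not_reachable fun h => ?_, key⟩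
  have hb := hT.not_reachable_sdiff_edge (hHT hwz)
  rcases key with ⟨h1, h2⟩ | ⟨h1, h2⟩
  · exact hb ((h1.mono hle).trans (h.trans (h2.mono hle)))
  · exact hb ((h1.mono hle).trans (h.symm.trans (h2.mono hle)))

lemma sum_ncard_neighborSet_add_ncard_edgeSet_within_compl_le [Finite V] (T : SimpleGraph V)
    (S : Finset V) :
    ∑ s ∈ S, (T.neighborSet s).ncard + (T.within (↑S)ᶜ).edgeSet.ncard ≤
      T.edgeSet.ncard + (T.within ↑S).edgeSet.ncard := by
  classical
  have := Fintype.ofFinite V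
  have hdeg (s : V) : (T.neighborSet s).ncard = (T.edgeFinset.filter (s ∈ ·)).card := by
    rw [← incidenceFinset_eq_filter, card_incidenceFinset_eq_degree,
      Set.ncard_eq_toFinset_card', degree, neighborFinset]
  have hle (C : Set V) : (T.within C).edgeSet.ncard =
      ∑ e ∈ T.edgeFinset, if e ∈ (T.within C).edgeSet then 1 else 0 := by
    rw [← Finset.card_filter, ← Set.ncard_coe_finset]
    congr 1
    ext e
    have : e ∈ (T.within C).edgeSet → e ∈ T.edgeSet := fun h => edgeSet_mono (within_le C) h
    simpa using this
  have hcount := Finset.sum_card_bipartiteAbove_eq_sum_card_bipartiteBelow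
    (s := S) (t := T.edgeFinset) (fun s e => s ∈ e)
  simp only [Finset.bipartiteAbove, Finset.bipartiteBelow] at hcount
  rw [Finset.sum_congr rfl fun s _ => hdeg s, hcount, hle, hle, ← Finset.sum_add_distrib,
    Set.ncard_eq_toFinset_card', ← edgeFinset, Finset.card_eq_sum_ones, ← Finset.sum_add_distrib]
  refine Finset.sum_le_sum fun e he => ?_
  induction e using Sym2.ind with | h x y =>
  have hxy : T.Adj x y := by simpa using he
  simp only [Sym2.mem_iff, mem_edgeSet, within_adj, hxy, true_and, Set.mem_compl_iff,
    Finset.mem_coe]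
  have hsub (A : Finset V) (hA : ∀ a ∈ S, a = x ∨ a = y → a ∈ A) :
      (S.filter fun a => a = x ∨ a = y).card ≤ A.card :=
    Finset.card_le_card fun a ha => by
      rw [Finset.mem_filter] at ha
      exact hA a ha.1 ha.2
  by_cases hx : x ∈ S <;> by_cases hy : y ∈ S <;> simp only [hx, hy] <;> norm_num
  · exact (hsub {x, y} (by simp)).trans Finset.card_le_two
  · exact hsub {x} (by rintro a ha (rfl | rfl) <;> simp_all)
  · exact hsub {y} (by rintro a ha (rfl | rfl) <;> simp_all)
  · rintro a ha
    constructor <;> rintro rfl <;> contradiction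

lemma card_add_one_le_ncard_add_card_connectedComponent_within [Finite V] {S : Set V}
    (hS : S.Nonempty) (T : SimpleGraph V) :
    Nat.card V + 1 ≤ S.ncard + Nat.card (T.within S).ConnectedComponent := by
  obtain ⟨s, hs⟩ := hS
  let f : ↥(insert s Sᶜ) → (T.within S).ConnectedComponent :=
    fun x => (T.within S).connectedComponentMk x
  have hf : Function.Injective f := by
    rintro ⟨x, hx⟩ ⟨y, hy⟩ hxy
    have hr : (T.within S).Reachable x y := ConnectedComponent.eq.1 hxy
    rcases hx with rfl | hx
    · rcases hy with rfl | hy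
      · rfl
      · exact Subtype.ext (eq_of_reachable_within hy hr.symm).symm
    · exact Subtype.ext (eq_of_reachable_within hx hr)
  have hs' : s ∉ Sᶜ := fun h => h hs
  have h1 := Nat.card_le_card_of_injective f hf
  rw [Nat.card_coe_set_eq, Set.ncard_insert_of_notMem hs'] at h1
  have h2 := Set.ncard_add_ncard_compl S
  omega

lemma IsAcyclic.mul_ncard_add_card_connectedComponent_lt [Finite V] {S : Set V} {k : ℕ}
    (hT : T.IsAcyclic) (hS : S.Nonempty) (hdeg : ∀ s ∈ S, (T.neighborSet s).ncard = k) :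
    k * S.ncard + Nat.card T.ConnectedComponent <
      Nat.card (T.within Sᶜ).ConnectedComponent + S.ncard := by
  have h1 := hT.ncard_edgeSet_add_card_connectedComponent
  have h2 := (hT.anti (within_le S)).ncard_edgeSet_add_card_connectedComponent
  have h3 := (hT.anti (within_le Sᶜ)).ncard_edgeSet_add_card_connectedComponent
  have h4 := card_add_one_le_ncard_add_card_connectedComponent_within hS T
  obtain ⟨S, rfl⟩ := S.toFinite.exists_finset_coe
  have h5 := sum_ncard_neighborSet_add_ncard_edgeSet_within_compl_le T S
  rw [Finset.sum_congr rfl fun s hs => hdeg s hs, Finset.sum_const, smul_eq_mul] at h5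
  rw [Set.ncard_coe_finset] at h4 ⊢
  rw [mul_comm] at h5
  omega

lemma card_connectedComponent_within_compl_le [Finite V] {S : Set V}
    (h : ∀ x ∉ S, ∀ y ∉ S, G.Adj x y → (H.within Sᶜ).Reachable x y) :
    Nat.card (H.within Sᶜ).ConnectedComponent ≤
      Nat.card (induce Sᶜ G).ConnectedComponent + S.ncard := by
  classical
  let f : V → (induce Sᶜ G).ConnectedComponent ⊕ S := fun x =>
    if hx : x ∈ S then .inr ⟨x, hx⟩ else .inl ((induce Sᶜ G).connectedComponentMk ⟨x, hx⟩)
  have hf (x y : V) (hxy : f x = f y) : (H.within Sᶜ).Reachable x y := by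
    by_cases hx : x ∈ S <;> by_cases hy : y ∈ S <;> simp [f, hx, hy] at hxy
    · exact hxy ▸ .rfl
    · obtain ⟨p⟩ := hxy
      have key : ∀ {a b : ↥(Sᶜ)}, (induce Sᶜ G).Walk a b → (H.within Sᶜ).Reachable a b := by
        intro a b p
        induction p with
        | nil => rfl
        | @cons a b c e p ih => exact (h a a.2 b b.2 e).trans ih
      exact key p
  rw [← Nat.card_coe_set_eq, ← Nat.card_sum]
  refine Nat.card_le_card_of_injective (fun c => f (Quot.out c)) fun c d hcd => ?_
  rw [← Quot.out_eq c, ← Quot.out_eq d]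
  exact ConnectedComponent.sound (hf _ _ hcd)

/-- `T'` is a `k`-bounded forest in `G` which agrees with `T` on the edges meeting `S`, and has
the same components as `T` outside `S`. -/
structure IsRearrangement (G : SimpleGraph V) (k : ℕ) (T : SimpleGraph V) (S : Set V)
    (T' : SimpleGraph V) : Prop where
  le : T' ≤ G
  isAcyclic : T'.IsAcyclic
  ncard_le : ∀ v, (T'.neighborSet v).ncard ≤ k
  adj_iff : ∀ s ∈ S, ∀ x, T'.Adj s x ↔ T.Adj s x
  reachable_iff : ∀ x y, (T'.within Sᶜ).Reachable x y ↔ (T.within Sᶜ).Reachable x y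

namespace IsRearrangement

variable {k : ℕ} {S S' : Set V} {T' : SimpleGraph V}

lemma anti (h : IsRearrangement G k T S' T') (hS : S ⊆ S') : IsRearrangement G k T S T' where
  le := h.le
  isAcyclic := h.isAcyclic
  ncard_le := h.ncard_le
  adj_iff s hs := h.adj_iff s (hS hs)
  reachable_iff x y := by
    have hle (K : SimpleGraph V) : K.within S'ᶜ ≤ K.within Sᶜ := within_anti_compl hS
    constructor <;> refine Reachable.of_forall_adj fun a b hab => ?_
    · by_cases ha : a ∈ S'
      · exact Adj.reachable ⟨(h.adj_iff a ha b).1 hab.1, hab.2⟩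
      by_cases hb : b ∈ S'
      · exact Adj.reachable ⟨((h.adj_iff b hb a).1 hab.1.symm).symm, hab.2⟩
      exact ((h.reachable_iff a b).1 (Adj.reachable ⟨hab.1, ha, hb⟩)).mono (hle T)
    · by_cases ha : a ∈ S'
      · exact Adj.reachable ⟨(h.adj_iff a ha b).2 hab.1, hab.2⟩
      by_cases hb : b ∈ S'
      · exact Adj.reachable ⟨((h.adj_iff b hb a).2 hab.1.symm).symm, hab.2⟩
      exact ((h.reachable_iff a b).2 (Adj.reachable ⟨hab.1, ha, hb⟩)).mono (hle T')

/-- Rearrangements can be carried out independently in different components outside `S`. -/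
lemma exists_combine [Finite V] {Tu Tv : SimpleGraph V} {u v : V}
    (hTu : IsRearrangement G k T S Tu) (hTv : IsRearrangement G k T S Tv) (hu : u ∉ S)
    (huv : ¬ (T.within Sᶜ).Reachable u v) :
    ∃ T', IsRearrangement G k T S T' ∧ T'.neighborSet u = Tu.neighborSet u ∧
      T'.neighborSet v = Tv.neighborSet v := by
  let C : Set V := {x | (T.within Sᶜ).Reachable u x}
  have hCS {x : V} (hx : x ∈ C) : x ∉ S := fun hxS => by
    have : x = u := eq_of_reachable_within (Set.notMem_compl_iff.2 hxS) (Reachable.symm hx)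
    exact hu (this ▸ hxS)
  have hmem {x y : V} (hx : x ∈ C) (hy : (T.within Sᶜ).Reachable x y) : y ∈ C :=
    Reachable.trans hx hy
  have hstep {K : SimpleGraph V} (hK : IsRearrangement G k T S K) {x y : V} (hx : x ∉ S)
      (hy : y ∉ S) (e : K.Adj x y) : (T.within Sᶜ).Reachable x y :=
    (hK.reachable_iff x y).1 (Adj.reachable ⟨e, hx, hy⟩)
  let T' : SimpleGraph V := Tu.within C ⊔ Tv \ Tv.within C
  have hadj_def (x y : V) : T'.Adj x y ↔
      (Tu.Adj x y ∧ x ∈ C ∧ y ∈ C) ∨ (Tv.Adj x y ∧ ¬ (Tv.Adj x y ∧ x ∈ C ∧ y ∈ C)) := Iff.rfl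
  have hadj_not_mem {x : V} (hx : x ∉ C) (y : V) : T'.Adj x y ↔ Tv.Adj x y := by
    rw [hadj_def]; tauto
  have hadj_mem {x : V} (hx : x ∈ C) (y : V) : T'.Adj x y ↔ Tu.Adj x y := by
    rw [hadj_def]
    by_cases hy : y ∈ C
    · tauto
    by_cases hyS : y ∈ S
    · have h1 := hTu.adj_iff y hyS x
      have h2 := hTv.adj_iff y hyS x
      rw [adj_comm, adj_comm T] at h1 h2
      tauto
    · have h1 : ¬ Tu.Adj x y := fun e => hy (hmem hx (hstep hTu (hCS hx) hyS e))
      have h2 : ¬ Tv.Adj x y := fun e => hy (hmem hx (hstep hTv (hCS hx) hyS e))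
      tauto
  have hset_mem {x : V} (hx : x ∈ C) : T'.neighborSet x = Tu.neighborSet x :=
    Set.ext (hadj_mem hx)
  have hset_not_mem {x : V} (hx : x ∉ C) : T'.neighborSet x = Tv.neighborSet x :=
    Set.ext (hadj_not_mem hx)
  refine ⟨T', ⟨?_, ?_, ?_, ?_, ?_⟩, hset_mem (Reachable.refl (G := T.within Sᶜ) u),
    hset_not_mem huv⟩
  · exact sup_le ((within_le C).trans hTu.le) (sdiff_le.trans hTv.le)
  · refine IsAcyclic.sup_of_reachable (F' := Tv.within C) (hTu.isAcyclic.anti (within_le C)) ?_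
      disjoint_sdiff_self_right ?_
    · rintro x y ⟨e, hx, hy⟩
      have hr := (hTv.reachable_iff x y).2 (hstep hTu (hCS hx) (hCS hy) e)
      refine Reachable.of_forall_adj_of_mem (C := C) (fun a ha b e => ?_) hx hr
      have hb : b ∈ C := hmem ha ((hTv.reachable_iff a b).1 e.reachable)
      exact ⟨hb, Adj.reachable ⟨e.1, ha, hb⟩⟩
    · rw [sup_sdiff_cancel_right (within_le C)]
      exact hTv.isAcyclic
  · intro x
    by_cases hx : x ∈ C
    · exact hset_mem hx ▸ hTu.ncard_le x
    · exact hset_not_mem hx ▸ hTv.ncard_le x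
  · intro s hs x
    rw [hadj_not_mem (fun h => hCS h hs), hTv.adj_iff s hs]
  · intro x y
    constructor
    · refine Reachable.of_forall_adj fun a b e => ?_
      by_cases ha : a ∈ C
      · exact hstep hTu e.2.1 e.2.2 ((hadj_mem ha b).1 e.1)
      · exact hstep hTv e.2.1 e.2.2 ((hadj_not_mem ha b).1 e.1)
    · intro hr
      by_cases hx : x ∈ C
      · refine Reachable.of_forall_adj_of_mem (C := C) (fun a ha b e => ?_) hx
          ((hTu.reachable_iff x y).2 hr)
        exact ⟨hmem ha ((hTu.reachable_iff a b).1 e.reachable),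
          Adj.reachable ⟨(hadj_mem ha b).2 e.1, e.2⟩⟩
      · refine Reachable.of_forall_adj_of_mem (C := Cᶜ) (fun a ha b e => ?_) hx
          ((hTv.reachable_iff x y).2 hr)
        exact ⟨fun hb => ha (hmem hb ((hTv.reachable_iff a b).1 e.reachable).symm),
          Adj.reachable ⟨(hadj_not_mem ha b).2 e.1, e.2⟩⟩

end IsRearrangement

lemma ncard_neighborSet_sup_edge_le [Finite V] {u v : V} (H : SimpleGraph V) :
    ((H ⊔ edge u v).neighborSet u).ncard ≤ (H.neighborSet u).ncard + 1 := by
  refine (Set.ncard_le_ncard (t := insert v (H.neighborSet u)) ?_).trans (Set.ncard_insert_le _ _)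
  rintro x (h | h)
  · exact .inr h
  · rw [edge_adj] at h
    grind

lemma neighborSet_sup_edge_of_ne {u v x : V} (H : SimpleGraph V) (hu : x ≠ u) (hv : x ≠ v) :
    (H ⊔ edge u v).neighborSet x = H.neighborSet x := by
  ext y
  simp [edge_adj, hu, hv]

lemma ncard_neighborSet_sup_edge_le_of_lt [Finite V] {u v : V} {k : ℕ}
    (hH : ∀ x, (H.neighborSet x).ncard ≤ k) (hu : (H.neighborSet u).ncard < k)
    (hv : (H.neighborSet v).ncard < k) (x : V) : ((H ⊔ edge u v).neighborSet x).ncard ≤ k := by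
  by_cases hxu : x = u
  · subst hxu
    exact (ncard_neighborSet_sup_edge_le H).trans hu
  by_cases hxv : x = v
  · subst hxv
    rw [edge_comm]
    exact (ncard_neighborSet_sup_edge_le H).trans hv
  rw [neighborSet_sup_edge_of_ne H hxu hxv]
  exact hH x

/-- No rearrangement of `T` fixing `S` frees a degree at both ends of an edge of `G` joining two
components outside `S`. -/
def IsBlocking (G : SimpleGraph V) (k : ℕ) (T : SimpleGraph V) (S : Set V) : Prop :=
  ∀ T', IsRearrangement G k T S T' → ∀ u ∉ S, ∀ v ∉ S, G.Adj u v →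
    ¬ (T.within Sᶜ).Reachable u v → (T'.neighborSet u).ncard < k → ¬ (T'.neighborSet v).ncard < k

/-- The vertices of `S`, together with those of degree `k` in every rearrangement of `T`
fixing `S`. -/
def saturate (G : SimpleGraph V) (k : ℕ) (T : SimpleGraph V) (S : Set V) : Set V :=
  S ∪ {w | ∀ T', IsRearrangement G k T S T' → ¬ (T'.neighborSet w).ncard < k}

lemma IsBlocking.saturate [Finite V] {k : ℕ} {S : Set V} (h : IsBlocking G k T S) :
    IsBlocking G k T (saturate G k T S) := by
  intro T' hT' u hu v hv huv hn hdu hdv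
  have hT := hT'.anti (Set.subset_union_left : S ⊆ SimpleGraph.saturate G k T S)
  have huS : u ∉ S := fun h => hu (.inl h)
  have hvS : v ∉ S := fun h => hv (.inl h)
  by_cases hr : (T.within Sᶜ).Reachable u v
  swap
  · exact h T' hT u huS v hvS huv hr hdu hdv
  have hr' := (hT.reachable_iff u v).2 hr
  have hn' : ¬ ((T'.within Sᶜ).within (SimpleGraph.saturate G k T S)ᶜ).Reachable u v := by
    intro hc
    refine hn ((hT'.reachable_iff u v).1 (hc.mono ?_))
    exact fun x y e => ⟨e.1.1, e.2⟩
  obtain ⟨w, hw, z, hwz, hnwz⟩ :=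
    (hT.isAcyclic.anti (within_le Sᶜ)).exists_adj_not_reachable_sdiff_edge hv hr' hn'
  have hwu : w ≠ u := by rintro rfl; exact hu hw
  have hwv : w ≠ v := by rintro rfl; exact hv hw
  have hwS := hwz.2.1
  have hzS := hwz.2.2
  obtain ⟨hac, hends⟩ := hT.isAcyclic.exchange_edge (within_le Sᶜ) hwz hr' hnwz
  rcases hw with hw | hw
  · exact hwS hw
  have hsub (x : V) : ((T' \ edge w z).neighborSet x).ncard ≤ (T'.neighborSet x).ncard :=
    Set.ncard_le_ncard fun y hy => hy.1
  refine hw (T' \ edge w z ⊔ edge u v) ⟨?_, hac, ?_, ?_, ?_⟩ ?_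
  · exact sup_le (sdiff_le.trans hT.le) ((edge_le_iff _).2 (.inr huv))
  · exact ncard_neighborSet_sup_edge_le_of_lt (fun x => (hsub x).trans (hT.ncard_le x))
      ((hsub u).trans_lt hdu) ((hsub v).trans_lt hdv)
  · intro s hs x
    rw [← hT.adj_iff s hs]
    have h1 : s ≠ u := by rintro rfl; exact huS hs
    have h2 : s ≠ v := by rintro rfl; exact hvS hs
    have h3 : s ≠ w := by rintro rfl; exact hwS hs
    have h4 : s ≠ z := by rintro rfl; exact hzS hs
    simp [edge_adj, h1, h2, h3, h4]
  · intro x y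
    rw [← hT.reachable_iff]
    have hle : T'.within Sᶜ \ edge w z ≤ (T' \ edge w z ⊔ edge u v).within Sᶜ :=
      fun a b e => ⟨.inl ⟨e.1.1, e.2⟩, e.1.2⟩
    have huv' : ((T' \ edge w z ⊔ edge u v).within Sᶜ).Adj u v :=
      ⟨.inr (by simp [edge_adj, huv.ne]), huS, hvS⟩
    have hwz' : ((T' \ edge w z ⊔ edge u v).within Sᶜ).Reachable w z := by
      rcases hends with ⟨h1, h2⟩ | ⟨h1, h2⟩
      · exact (h1.mono hle).trans (huv'.reachable.trans (h2.mono hle))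
      · exact (h1.mono hle).trans (huv'.symm.reachable.trans (h2.mono hle))
    constructor <;> refine Reachable.of_forall_adj fun a b e => ?_
    · obtain ⟨e | e, he⟩ := e
      · exact Adj.reachable ⟨e.1, he⟩
      · rw [edge_adj] at e
        obtain ⟨⟨rfl, rfl⟩ | ⟨rfl, rfl⟩, -⟩ := e
        · exact hr'
        · exact hr'.symm
    · by_cases hab : (edge w z).Adj a b
      · rw [edge_adj] at hab
        obtain ⟨⟨rfl, rfl⟩ | ⟨rfl, rfl⟩, -⟩ := hab
        · exact hwz'
        · exact hwz'.symm
      · exact Adj.reachable (hle ⟨e, hab⟩)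
  · rw [neighborSet_sup_edge_of_ne _ hwu hwv]
    refine lt_of_lt_of_le (Set.ncard_lt_ncard ?_) (hT.ncard_le w)
    refine ⟨fun y hy => hy.1, fun hsub => ?_⟩
    have : (T' \ edge w z).Adj w z := hsub hwz.1
    simp [edge_adj, hwz.ne] at this

/-- **Win's theorem**: a connected graph with `ω(G - S) ≤ (k - 2)|S| + 2` for all `S` has a
spanning tree of maximum degree at most `k`. -/
theorem Connected.exists_isTree_ncard_neighborSet_le [Finite V] {k : ℕ} (hk : 2 ≤ k)
    (hG : G.Connected)
    (h : ∀ S : Set V, Nat.card (induce Sᶜ G).ConnectedComponent ≤ (k - 2) * S.ncard + 2) :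
    ∃ T ≤ G, T.IsTree ∧ ∀ v, (T.neighborSet v).ncard ≤ k := by
  have hne := hG.nonempty
  obtain ⟨T, ⟨hTG, hTac, hTdeg⟩, hTmax⟩ := Set.Finite.exists_maximalFor
    (fun T : SimpleGraph V => T.Reachable)
    {T | T ≤ G ∧ T.IsAcyclic ∧ ∀ v, (T.neighborSet v).ncard ≤ k} (Set.toFinite _)
    ⟨⊥, bot_le, isAcyclic_bot, fun v => by simp [neighborSet]⟩
  have hself (S : Set V) : IsRearrangement G k T S T :=
    ⟨hTG, hTac, hTdeg, fun _ _ _ => Iff.rfl, fun _ _ => Iff.rfl⟩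
  have hwithin (K : SimpleGraph V) : K.within ∅ᶜ = K := by
    ext x y
    simp [within_adj]
  have hempty : IsBlocking G k T ∅ := by
    intro T' hT' u _ v _ huv hn hdu hdv
    have hreach := hT'.reachable_iff
    simp only [hwithin] at hreach hn
    have hac := hT'.isAcyclic.sup_edge_of_not_reachable ((hreach u v).not.2 hn)
    have := hTmax (j := T' ⊔ edge u v) ⟨sup_le hT'.le ((edge_le_iff _).2 (.inr huv)), hac,
      ncard_neighborSet_sup_edge_le_of_lt hT'.ncard_le hdu hdv⟩
      (fun x y hxy => ((hreach x y).2 hxy).mono le_sup_left) u v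
      (Adj.reachable (.inr (by simp [edge_adj, huv.ne])))
    exact hn this
  obtain ⟨S, ⟨hS, hSdeg⟩, hSmax⟩ := Set.Finite.exists_maximalFor id
    {S : Set V | IsBlocking G k T S ∧ ∀ s ∈ S, (T.neighborSet s).ncard = k} (Set.toFinite _)
    ⟨∅, hempty, by simp⟩
  have hsat : saturate G k T S ⊆ S := by
    refine hSmax ⟨hS.saturate, fun s hs => ?_⟩ Set.subset_union_left
    rcases hs with hs | hs
    · exact hSdeg s hs
    · exact le_antisymm (hTdeg s) (not_lt.1 (hs T (hself S)))
  have hfree (x : V) (hx : x ∉ S) :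
      ∃ T', IsRearrangement G k T S T' ∧ (T'.neighborSet x).ncard < k := by
    by_contra! hcon
    exact hx (hsat (.inr fun T' hT' => not_lt.2 (hcon T' hT')))
  have hGS : ∀ x ∉ S, ∀ y ∉ S, G.Adj x y → (T.within Sᶜ).Reachable x y := by
    intro x hx y hy hxy
    by_contra hn
    obtain ⟨Tx, hTx, hdx⟩ := hfree x hx
    obtain ⟨Ty, hTy, hdy⟩ := hfree y hy
    obtain ⟨T', hT', hx', hy'⟩ := hTx.exists_combine hTy hx hn
    exact hS T' hT' x hx y hy hxy hn (hx' ▸ hdx) (hy' ▸ hdy)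
  by_cases hconn : T.Connected
  · exact ⟨T, hTG, ⟨hconn, hTac⟩, hTdeg⟩
  exfalso
  have hSne : S.Nonempty := by
    by_contra hSe
    obtain rfl := Set.not_nonempty_iff_eq_empty.1 hSe
    simp only [hwithin] at hGS
    refine hconn ⟨fun x y => ?_⟩
    exact Reachable.of_forall_adj (fun a b => hGS a (by simp) b (by simp)) (hG.preconnected x y)
  have hT2 : 2 ≤ Nat.card T.ConnectedComponent := by
    by_contra! hlt
    have : Subsingleton T.ConnectedComponent :=
      Finite.card_le_one_iff_subsingleton.1 (Nat.lt_succ_iff.1 hlt)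
    exact hconn ⟨fun x y => ConnectedComponent.eq.1 (Subsingleton.elim _ _)⟩
  have h1 := hTac.mul_ncard_add_card_connectedComponent_lt hSne hSdeg
  have h2 := card_connectedComponent_within_compl_le hGS
  have h3 := h S
  obtain ⟨j, rfl⟩ := Nat.exists_eq_add_of_le' hk
  rw [Nat.add_sub_cancel] at h3
  rw [add_mul] at h1
  omega

end SimpleGraph

/-- **Lemma (Statement 5) (Win; Ellingham–Zha).** Let `k ≥ 3`. If a connected graph
`G` satisfies `ω(G - S) ≤ (k-2)|S| + 2` for every vertex subset `S`, then `G`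
admits a spanning `k`-tree. -/
theorem hasSpanningKTree_of_components_le {V : Type*} [Fintype V]
    (k : ℕ) (hk : 3 ≤ k) (G : SimpleGraph V) (hG : G.Connected)
    (h : ∀ S : Set V,
      Nat.card (SimpleGraph.induce Sᶜ G).ConnectedComponent ≤ (k - 2) * S.ncard + 2) :
    HasSpanningKTree G k := by
  exact hG.exists_isTree_ncard_neighborSet_le (by omega) h
end

section
/- Let k ≥ 4 and s ≥ 1 be integers and let n ≥ (k−1)s + 4. Then λ₁(D(K₁ ∨ (K_{n-k-1} ∪ kK₁))) ≤ λ₁(D(K_s ∨ (K_{n-(k-1)s-2} ∪ ((k−2)s+2)K₁))), with equality if and only if s = 1 (i.e., if and only if the two graphs are isomorphic). -/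
open Matrix in
/-- A nonnegative matrix with a positive eigenvector has the corresponding eigenvalue as the
largest element of its spectrum. -/
theorem sSup_spectrum_eq_of_pos_eigenvector {V : Type*} [Fintype V] [DecidableEq V] [Nonempty V]
    (A : Matrix V V ℝ) (hA : ∀ i j, 0 ≤ A i j) (v : V → ℝ) (hv : ∀ i, 0 < v i) (ρ : ℝ)
    (h : A *ᵥ v = ρ • v) : sSup (spectrum ℝ A) = ρ := by
  have mem_iff : ∀ μ : ℝ, μ ∈ spectrum ℝ A ↔ ∃ u : V → ℝ, u ≠ 0 ∧ A *ᵥ u = μ • u := by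
    intro μ
    rw [← Matrix.spectrum_toLin', ← Module.End.hasEigenvalue_iff_mem_spectrum]
    constructor
    · intro hμ
      obtain ⟨u, hu⟩ := hμ.exists_hasEigenvector
      exact ⟨u, hu.2, by simpa using hu.apply_eq_smul⟩
    · rintro ⟨u, hu0, hu⟩
      exact Module.End.hasEigenvalue_of_hasEigenvector
        (x := u) ⟨Module.End.mem_eigenspace_iff.2 (by simpa using hu), hu0⟩
  refine IsGreatest.csSup_eq ⟨(mem_iff ρ).2 ⟨v, ?_, h⟩, ?_⟩
  · intro h0
    obtain ⟨i⟩ := ‹Nonempty V›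
    simpa [h0] using hv i
  · intro μ hμ
    obtain ⟨u, hu0, hu⟩ := (mem_iff μ).1 hμ
    obtain ⟨i, hi⟩ := Finite.exists_max (fun i => |u i| / v i)
    have hle : ∀ j, |u j| ≤ |u i| / v i * v j := fun j => (div_le_iff₀ (hv j)).1 (hi j)
    have hpos : 0 < |u i| := by
      obtain ⟨j, hj⟩ := Function.ne_iff.1 hu0
      have hj' : 0 < |u j| := abs_pos.2 hj
      by_contra hn
      have h0 : |u i| = 0 := le_antisymm (not_lt.1 hn) (abs_nonneg _)
      have := hle j
      rw [h0] at this
      linarith [this, (by ring : (0 : ℝ) / v i * v j = 0 * (v j / v i))]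
    have hui : ∑ j, A i j * u j = μ * u i := by
      simpa [Matrix.mulVec, dotProduct] using congrFun hu i
    have hvi : ∑ j, A i j * v j = ρ * v i := by
      simpa [Matrix.mulVec, dotProduct] using congrFun h i
    have key : |μ| * |u i| ≤ ρ * |u i| := by
      calc |μ| * |u i| = |∑ j, A i j * u j| := by rw [hui, abs_mul]
        _ ≤ ∑ j, |A i j * u j| := Finset.abs_sum_le_sum_abs _ _
        _ ≤ ∑ j, A i j * (|u i| / v i * v j) := by
            refine Finset.sum_le_sum fun j _ => ?_
            rw [abs_mul, abs_of_nonneg (hA i j)]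
            exact mul_le_mul_of_nonneg_left (hle j) (hA i j)
        _ = |u i| / v i * ∑ j, A i j * v j := by
            rw [Finset.mul_sum]
            exact Finset.sum_congr rfl fun j _ => by ring
        _ = ρ * |u i| := by
            rw [hvi]
            field_simp [(hv i).ne']
    exact (le_abs_self μ).trans (le_of_mul_le_mul_right key hpos)

/-- The graph `K_a ∨ (K_m ∪ bK₁)`. -/
def cliqueJoin (a m b : ℕ) : SimpleGraph (Fin a ⊕ (Fin m ⊕ Fin b)) :=
  graphJoin (⊤ : SimpleGraph (Fin a))
    (graphDisjUnion (⊤ : SimpleGraph (Fin m)) (⊥ : SimpleGraph (Fin b)))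

theorem SimpleGraph.dist_eq_two_of_common_neighbor {V : Type*} {G : SimpleGraph V} {u v w : V}
    (hne : u ≠ v) (h : ¬ G.Adj u v) (huw : G.Adj u w) (hwv : G.Adj w v) : G.dist u v = 2 := by
  have hle : G.dist u v ≤ 2 := SimpleGraph.dist_le (.cons huw (.cons hwv .nil))
  have hr : G.Reachable u v := huw.reachable.trans hwv.reachable
  have h0 : G.dist u v ≠ 0 := fun h0 => hne (hr.dist_eq_zero_iff.1 h0)
  have h1 : G.dist u v ≠ 1 := fun h1 => h (SimpleGraph.dist_eq_one_iff_adj.1 h1)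
  omega

open Classical in
theorem cliqueJoin_dist {a m b : ℕ} (ha : 1 ≤ a) (u v : Fin a ⊕ (Fin m ⊕ Fin b)) :
    (cliqueJoin a m b).dist u v =
      if u = v then 0 else if (cliqueJoin a m b).Adj u v then 1 else 2 := by
  split_ifs with h h'
  · simp [h]
  · exact SimpleGraph.dist_eq_one_iff_adj.2 h'
  · have left_adj : ∀ w, w ≠ Sum.inl ⟨0, ha⟩ →
        (cliqueJoin a m b).Adj (Sum.inl ⟨0, ha⟩) w := by
      rintro (w | w) hw
      · simp only [cliqueJoin, graphJoin, SimpleGraph.fromRel_adj]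
        exact ⟨hw.symm, Or.inl (Or.inl (Sum.LiftRel.inl fun e => hw (by rw [e])))⟩
      · simp [cliqueJoin, graphJoin]
    refine SimpleGraph.dist_eq_two_of_common_neighbor (w := Sum.inl ⟨0, ha⟩) h h'
      (left_adj u ?_).symm (left_adj v ?_)
    · rintro rfl
      exact h' (left_adj v (Ne.symm h))
    · rintro rfl
      exact h' (left_adj u h).symm

theorem Fin.sum_ite_eq_zero_else {N : ℕ} (i : Fin N) (c : ℝ) :
    ∑ j : Fin N, (if i = j then 0 else c) = ((N : ℝ) - 1) * c := by
  have : ∀ j : Fin N, (if i = j then 0 else c) = c - if i = j then c else 0 := by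
    intro j
    split_ifs <;> simp
  simp_rw [this]
  simp [Finset.sum_sub_distrib]
  ring

/-- The distance spectral radius of `K_a ∨ (K_m ∪ bK₁)` is read off a positive eigenvector of the
quotient matrix. -/
theorem distSpecRad_cliqueJoin {a m b : ℕ} (ha : 1 ≤ a) {x y z ρ : ℝ} (hx : 0 < x) (hy : 0 < y)
    (hz : 0 < z) (h1 : ρ * x = (a - 1) * x + m * y + b * z)
    (h2 : ρ * y = a * x + (m - 1) * y + 2 * b * z)
    (h3 : ρ * z = a * x + 2 * m * y + 2 * (b - 1) * z) :
    distSpecRad (cliqueJoin a m b) = ρ := by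
  have : Nonempty (Fin a ⊕ (Fin m ⊕ Fin b)) := ⟨Sum.inl ⟨0, ha⟩⟩
  refine sSup_spectrum_eq_of_pos_eigenvector _ (fun i j => by simp [distMatrix])
    (Sum.elim (fun _ => x) (Sum.elim (fun _ => y) (fun _ => z))) ?_ ρ ?_
  · rintro (i | i | i) <;> simpa
  · funext i
    rcases i with i | i | i
    · simp only [Matrix.mulVec, dotProduct, distMatrix, Matrix.of_apply, cliqueJoin_dist ha]
      simp [cliqueJoin, graphJoin, graphDisjUnion, Fintype.sum_sum_type]
      rw [Finset.sum_congr rfl fun j _ => show _ = if i = j then 0 else x by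
        by_cases h : i = j <;> simp [h, eq_comm], Fin.sum_ite_eq_zero_else]
      linarith
    · simp only [Matrix.mulVec, dotProduct, distMatrix, Matrix.of_apply, cliqueJoin_dist ha]
      simp [cliqueJoin, graphJoin, graphDisjUnion, Fintype.sum_sum_type]
      rw [Finset.sum_congr rfl fun j _ => show _ = if i = j then 0 else y by
        by_cases h : i = j <;> simp [h, eq_comm], Fin.sum_ite_eq_zero_else]
      linarith
    · simp only [Matrix.mulVec, dotProduct, distMatrix, Matrix.of_apply, cliqueJoin_dist ha]
      simp [cliqueJoin, graphJoin, graphDisjUnion, Fintype.sum_sum_type]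
      rw [Fin.sum_ite_eq_zero_else]
      linarith

/-- The characteristic cubic of the quotient matrix of `K_a ∨ (K_m ∪ bK₁)`, in the variable
`λ + 1`. -/
def quotientCubic (a m b L : ℝ) : ℝ :=
  (L - a - m) * L * (L + 1) - b * (L + m) * (2 * L - a)

theorem distSpecRad_cliqueJoin_of_root {a m b : ℕ} (ha : 1 ≤ a) (hm : 1 ≤ m) {L : ℝ}
    (hL : (a : ℝ) < L) (hroot : quotientCubic a m b L = 0) :
    distSpecRad (cliqueJoin a m b) = L - 1 := by
  have ha' : (1 : ℝ) ≤ a := by exact_mod_cast ha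
  have hm' : (1 : ℝ) ≤ m := by exact_mod_cast hm
  have hb : (0 : ℝ) ≤ b := b.cast_nonneg
  have hL0 : 0 < L := by linarith
  unfold quotientCubic at hroot
  have hLa : 0 < L - a := by linarith
  refine distSpecRad_cliqueJoin ha (x := (m * (L + 1) + b * (L + m)))
    (y := (L - a) * (L + 1)) (z := (L - a) * (L + m)) (by positivity) (by positivity)
    (by positivity) ?_ ?_ ?_
  · ring
  · linarith
  · linarith

theorem exists_quotientCubic_root {a m b L₀ : ℝ} (ha : 0 ≤ a) (hm : 0 ≤ m) (hb : 0 ≤ b)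
    (h : quotientCubic a m b L₀ < 0) :
    ∃ L, L₀ < L ∧ quotientCubic a m b L = 0 := by
  have hcont : Continuous (quotientCubic a m b) := by
    unfold quotientCubic
    fun_prop
  obtain ⟨M, hM, hMpos⟩ : ∃ M, L₀ ≤ M ∧ 0 ≤ quotientCubic a m b M := by
    refine ⟨max L₀ (a + m + 4 * b), le_max_left _ _, ?_⟩
    have hM := le_max_right L₀ (a + m + 4 * b)
    generalize max L₀ (a + m + 4 * b) = M at hM
    have hM0 : 0 ≤ M := by linarith
    have h1 : 4 * b * (M * (M + 1)) ≤ (M - a - m) * (M * (M + 1)) :=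
      mul_le_mul_of_nonneg_right (by linarith) (by positivity)
    have h2 : b * ((M + m) * (2 * M - a)) ≤ b * ((2 * M) * (2 * M)) :=
      mul_le_mul_of_nonneg_left
        ((mul_le_mul_of_nonneg_left (by linarith) (by positivity)).trans
          (mul_le_mul_of_nonneg_right (by linarith) (by positivity))) hb
    have h3 : 0 ≤ b * M := by positivity
    unfold quotientCubic
    linarith
  obtain ⟨L, hL, hL0⟩ := intermediate_value_Icc hM hcont.continuousOn ⟨h.le, hMpos⟩
  refine ⟨L, lt_of_le_of_ne hL.1 ?_, hL0⟩
  rintro rfl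
  exact h.ne hL0

theorem distSpecRad_cliqueJoin_lt {j r p : ℕ} :
    distSpecRad (cliqueJoin 1 (2 + p + (j + 3) * (r + 1)) (j + 4)) <
      distSpecRad (cliqueJoin (r + 2) (2 + p) ((j + 2) * (r + 2) + 2)) := by
  have hj : (0 : ℝ) ≤ j := j.cast_nonneg
  have hr : (0 : ℝ) ≤ r := r.cast_nonneg
  have hp : (0 : ℝ) ≤ p := p.cast_nonneg
  obtain ⟨L, hL, hroot⟩ : ∃ L : ℝ, 2 + (p : ℝ) + (j + 3) * (r + 1) + 1 + 2 * (j + 4) < L ∧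
      quotientCubic 1 (2 + p + (j + 3) * (r + 1)) (j + 4) L = 0 := by
    apply exists_quotientCubic_root (by positivity) (by positivity) (by positivity)
    unfold quotientCubic
    rw [← neg_pos]
    ring_nf
    positivity
  obtain ⟨L', hL', hroot'⟩ : ∃ L' : ℝ, L < L' ∧
      quotientCubic (r + 2) (2 + p) ((j + 2) * (r + 2) + 2) L' = 0 := by
    apply exists_quotientCubic_root (by positivity) (by positivity) (by positivity)
    obtain ⟨q, rfl⟩ : ∃ q, L = 2 + (p : ℝ) + (j + 3) * (r + 1) + 1 + 2 * (j + 4) + q :=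
      ⟨_, (add_sub_cancel _ _).symm⟩
    have hq : 0 ≤ q := by linarith
    refine lt_of_lt_of_eq (sub_pos.1 ?_) hroot
    unfold quotientCubic
    ring_nf
    positivity
  have hprod : 0 ≤ (j : ℝ) * r := mul_nonneg hj hr
  rw [distSpecRad_cliqueJoin_of_root le_rfl (by omega) (L := L) (by push_cast; nlinarith)
      (by push_cast; exact hroot),
    distSpecRad_cliqueJoin_of_root (by omega) (by omega) (L := L') (by push_cast; nlinarith)
      (by push_cast; exact hroot')]
  linarith

/-- **Claim 2 (Statement 8).** Let `k ≥ 4`, `s ≥ 1` and `n ≥ (k-1)s + 4`. Then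
`λ₁(D(K₁ ∨ (K_{n-k-1} ∪ kK₁))) ≤ λ₁(D(K_s ∨ (K_{n-(k-1)s-2} ∪ ((k-2)s+2)K₁)))`,
with equality iff `s = 1`. -/
theorem distSpecRad_star_le_tilde (k s n : ℕ) (hk : 4 ≤ k) (hs : 1 ≤ s)
    (hn : (k - 1) * s + 4 ≤ n) :
    distSpecRad (starGraph n k) ≤ distSpecRad (tildeGraph n k s) ∧
    (distSpecRad (starGraph n k) = distSpecRad (tildeGraph n k s) ↔ s = 1) := by
  change distSpecRad (cliqueJoin 1 (n - k - 1) k) ≤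
      distSpecRad (cliqueJoin s (n - (k - 1) * s - 2) ((k - 2) * s + 2)) ∧
    (distSpecRad (cliqueJoin 1 (n - k - 1) k) =
      distSpecRad (cliqueJoin s (n - (k - 1) * s - 2) ((k - 2) * s + 2)) ↔ s = 1)
  obtain ⟨j, rfl⟩ := Nat.exists_eq_add_of_le' hk
  obtain rfl | hs2 := hs.eq_or_lt
  · rw [show n - (j + 4 - 1) * 1 - 2 = n - (j + 4) - 1 by omega,
      show (j + 4 - 2) * 1 + 2 = j + 4 by omega]
    simp
  · obtain ⟨r, rfl⟩ := Nat.exists_eq_add_of_le' (show 2 ≤ s from hs2)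
    obtain ⟨p, rfl⟩ := Nat.exists_eq_add_of_le' hn
    have hm : p + ((j + 4 - 1) * (r + 2) + 4) - (j + 4) - 1 = 2 + p + (j + 3) * (r + 1) := by
      rw [show j + 4 - 1 = j + 3 by omega, show (j + 3) * (r + 2) = (j + 3) * (r + 1) + (j + 3) by ring]
      omega
    have hm' : p + ((j + 4 - 1) * (r + 2) + 4) - (j + 4 - 1) * (r + 2) - 2 = 2 + p := by omega
    rw [hm, hm', show j + 4 - 2 = j + 2 by omega]
    have hlt := distSpecRad_cliqueJoin_lt (j := j) (r := r) (p := p)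
    exact ⟨hlt.le, iff_of_false hlt.ne (by omega)⟩
end

section
/- Let n ≥ 6 be an integer with n ≡ 0 (mod 3). Then the distance spectral radius of the graph K_{(n-3)/3} ∨ ((2n+3)/3)K₁ equals (5n − 6 + √(17n² + 24n))/6. -/
/-- Distances in the join `K_α ∨ βK₁` are `1` between different vertices of the clique and between
the two parts, and `2` between different vertices of the independent set. -/
theorem distMatrix_graphJoin_top_bot {α β : Type*} [Fintype α] [Fintype β] [DecidableEq α]
    [DecidableEq β] [Nonempty α] :
    distMatrix (graphJoin (⊤ : SimpleGraph α) (⊥ : SimpleGraph β)) =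
      Matrix.fromBlocks (Matrix.of fun i j => if i = j then 0 else 1)
        (Matrix.of fun _ _ => 1) (Matrix.of fun _ _ => 1)
        (Matrix.of fun i j => if i = j then 0 else 2) := by
  have adj_lr (i : α) (j : β) :
      (graphJoin (⊤ : SimpleGraph α) (⊥ : SimpleGraph β)).Adj (.inl i) (.inr j) := by
    simp [graphJoin]
  ext u v
  rcases u with i | i <;> rcases v with j | j
  · rcases eq_or_ne i j with rfl | h
    · simp [distMatrix]
    · have : (graphJoin (⊤ : SimpleGraph α) (⊥ : SimpleGraph β)).Adj (.inl i) (.inl j) := by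
        simp [graphJoin, h]
      simp [distMatrix, h, SimpleGraph.dist_eq_one_iff_adj.mpr this]
  · simp [distMatrix, SimpleGraph.dist_eq_one_iff_adj.mpr (adj_lr i j)]
  · simp [distMatrix, SimpleGraph.dist_eq_one_iff_adj.mpr (adj_lr j i).symm]
  · rcases eq_or_ne i j with rfl | h
    · simp [distMatrix]
    · obtain ⟨k⟩ := ‹Nonempty α›
      let w : (graphJoin (⊤ : SimpleGraph α) (⊥ : SimpleGraph β)).Walk (.inr i) (.inr j) :=
        .cons (adj_lr k i).symm (.cons (adj_lr k j) .nil)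
      have hle : (graphJoin (⊤ : SimpleGraph α) (⊥ : SimpleGraph β)).dist (.inr i) (.inr j) ≤ 2 :=
        SimpleGraph.dist_le w
      have hpos := w.reachable.pos_dist_of_ne (by simpa using h)
      have hne : (graphJoin (⊤ : SimpleGraph α) (⊥ : SimpleGraph β)).dist (.inr i) (.inr j) ≠ 1 := by
        rw [Ne, SimpleGraph.dist_eq_one_iff_adj]
        simp [graphJoin]
      have h2 : (graphJoin (⊤ : SimpleGraph α) (⊥ : SimpleGraph β)).dist (.inr i) (.inr j) = 2 := by
        omega
      simp [distMatrix, h, h2]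

theorem sum_ite_eq_zero_mul {α : Type*} [Fintype α] [DecidableEq α] (c : ℝ) (i : α) (x : α → ℝ) :
    ∑ j, (if i = j then 0 else c) * x j = c * (∑ j, x j) - c * x i := by
  have (j : α) : (if i = j then 0 else c) * x j = c * x j - if i = j then c * x j else 0 := by
    split_ifs <;> ring
  simp [this, Finset.sum_sub_distrib, Finset.mul_sum]

/-- A real number is a distance eigenvalue of `K_α ∨ βK₁` iff the eigenvalue equations have a
nonzero solution. -/
theorem mem_spectrum_distMatrix_graphJoin_top_bot {α β : Type*} [Fintype α] [Fintype β]
    [DecidableEq α] [DecidableEq β] [Nonempty α] (μ : ℝ) :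
    μ ∈ spectrum ℝ (distMatrix (graphJoin (⊤ : SimpleGraph α) (⊥ : SimpleGraph β))) ↔
      ∃ (x : α → ℝ) (y : β → ℝ), (x ≠ 0 ∨ y ≠ 0) ∧
        (∀ i, (μ + 1) * x i = ∑ k, x k + ∑ k, y k) ∧
        ∀ j, (μ + 2) * y j = ∑ k, x k + 2 * ∑ k, y k := by
  have key (v : α ⊕ β → ℝ) :
      (distMatrix (graphJoin (⊤ : SimpleGraph α) (⊥ : SimpleGraph β))).mulVec v = μ • v ↔
        (∀ i, (μ + 1) * v (.inl i) = ∑ k, v (.inl k) + ∑ k, v (.inr k)) ∧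
        ∀ j, (μ + 2) * v (.inr j) = ∑ k, v (.inl k) + 2 * ∑ k, v (.inr k) := by
    rw [distMatrix_graphJoin_top_bot, funext_iff, Sum.forall]
    simp only [Matrix.mulVec, dotProduct, Fintype.sum_sum_type, Matrix.fromBlocks_apply₁₁,
      Matrix.fromBlocks_apply₁₂, Matrix.fromBlocks_apply₂₁, Matrix.fromBlocks_apply₂₂,
      Matrix.of_apply, sum_ite_eq_zero_mul, one_mul, Pi.smul_apply, smul_eq_mul]
    refine and_congr (forall_congr' fun i => ?_) (forall_congr' fun j => ?_) <;>
      constructor <;> intro h <;> linarith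
  rw [← Matrix.spectrum_toLin', ← Module.End.hasEigenvalue_iff_mem_spectrum]
  constructor
  · intro h
    obtain ⟨v, hv⟩ := h.exists_hasEigenvector
    have hv' := hv.apply_eq_smul
    rw [Matrix.toLin'_apply, key] at hv'
    refine ⟨fun i => v (.inl i), fun j => v (.inr j), ?_, hv'⟩
    by_contra! h0
    refine hv.2 (funext fun u => ?_)
    rcases u with i | j
    · exact congrFun h0.1 i
    · exact congrFun h0.2 j
  · rintro ⟨x, y, hne, h⟩
    refine Module.End.hasEigenvalue_of_hasEigenvector (x := Sum.elim x y)
      ⟨Module.End.mem_eigenspace_iff.mpr ?_, ?_⟩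
    · rw [Matrix.toLin'_apply, key]
      simpa using h
    · intro h0
      rcases hne with hx | hy
      · exact hx (funext fun i => congrFun h0 (.inl i))
      · exact hy (funext fun j => congrFun h0 (.inr j))

/-- The distance spectral radius of `K_a ∨ bK₁`. -/
theorem distSpecRad_graphJoin_top_bot {α β : Type*} [Fintype α] [Fintype β]
    [DecidableEq α] [DecidableEq β] [Nonempty α] [Nonempty β] {a b : ℝ}
    (ha : (Fintype.card α : ℝ) = a) (hb : (Fintype.card β : ℝ) = b) :
    distSpecRad (graphJoin (⊤ : SimpleGraph α) (⊥ : SimpleGraph β)) =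
      (a + 2 * b - 3 + √((a - 2 * b + 1) ^ 2 + 4 * a * b)) / 2 := by
  have ha1 : 1 ≤ a := by
    rw [← ha]
    exact_mod_cast Fintype.card_pos
  have hb1 : 1 ≤ b := by
    rw [← hb]
    exact_mod_cast Fintype.card_pos
  have hd : 0 ≤ (a - 2 * b + 1) ^ 2 + 4 * a * b := by positivity
  have hsq := Real.sq_sqrt hd
  have hs : |a - 2 * b + 1| ≤ √((a - 2 * b + 1) ^ 2 + 4 * a * b) :=
    Real.abs_le_sqrt (by nlinarith)
  set s := √((a - 2 * b + 1) ^ 2 + 4 * a * b)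
  refine IsGreatest.csSup_eq ⟨?_, fun μ hμ => ?_⟩
  · rw [mem_spectrum_distMatrix_graphJoin_top_bot]
    refine ⟨fun _ => b, fun _ => (a + 2 * b - 3 + s) / 2 + 1 - a, Or.inl fun h => ?_, ?_, ?_⟩
    · obtain ⟨i⟩ := ‹Nonempty α›
      have := congrFun h i
      simp only [Pi.zero_apply] at this
      linarith
    all_goals
      intro _
      simp only [Finset.sum_const, Finset.card_univ, nsmul_eq_mul, ha, hb]
      linarith
  · rw [mem_spectrum_distMatrix_graphJoin_top_bot] at hμ
    obtain ⟨x, y, hne, hx, hy⟩ := hμ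
    rcases le_or_gt μ 0 with h0 | h0
    · linarith [le_abs_self (a - 2 * b + 1)]
    have hX : (μ + 1) * ∑ k, x k = a * (∑ k, x k + ∑ k, y k) := by
      rw [Finset.mul_sum]
      simp [hx, ha, mul_add]
    have hY : (μ + 2) * ∑ k, y k = b * (∑ k, x k + 2 * ∑ k, y k) := by
      rw [Finset.mul_sum]
      simp [hy, hb, mul_add]
    generalize ∑ k, x k = X at *
    generalize ∑ k, y k = Y at *
    have hquad : (μ + 1 - a) * (μ + 2 - 2 * b) = a * b := by
      by_contra hq
      have hX0 : X = 0 := by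
        refine (mul_eq_zero.mp ?_).resolve_left (sub_ne_zero.mpr hq)
        linear_combination (μ + 2 - 2 * b) * hX + a * hY
      have hY0 : Y = 0 := by
        refine (mul_eq_zero.mp ?_).resolve_left (sub_ne_zero.mpr hq)
        linear_combination (μ + 1 - a) * hY + b * hX
      subst hX0 hY0
      rcases hne with h | h
      · refine h (funext fun i => (mul_eq_zero.mp ((hx i).trans (by simp))).resolve_left ?_)
        positivity
      · refine h (funext fun j => (mul_eq_zero.mp ((hy j).trans (by simp))).resolve_left ?_)
        positivity
    have : 2 * μ - (a + 2 * b - 3) ≤ s :=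
      Real.le_sqrt_of_sq_le (by linarith)
    linarith

/-- For `n ≥ 6` with `3 ∣ n`, the distance spectral radius of
`K_{(n-3)/3} ∨ ((2n+3)/3)K₁` equals `(5n - 6 + √(17n² + 24n))/6`. -/
theorem distSpecRad_sharpGraph (n : ℕ) (hn : 6 ≤ n) (h3 : 3 ∣ n) :
    distSpecRad (sharpGraph n)
      = (5 * (n : ℝ) - 6 + Real.sqrt (17 * (n : ℝ) ^ 2 + 24 * (n : ℝ))) / 6 := by
  obtain ⟨m, rfl⟩ := h3
  have ha : (3 * m - 3) / 3 + 1 = m := by omega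
  have hb : (2 * (3 * m) + 3) / 3 = 2 * m + 1 := by omega
  have : Nonempty (Fin ((3 * m - 3) / 3)) := ⟨0, by omega⟩
  have : Nonempty (Fin ((2 * (3 * m) + 3) / 3)) := ⟨0, by omega⟩
  have ha' : (Fintype.card (Fin ((3 * m - 3) / 3)) : ℝ) = m - 1 := by
    rw [Fintype.card_fin, eq_sub_iff_add_eq]
    exact_mod_cast ha
  have hb' : (Fintype.card (Fin ((2 * (3 * m) + 3) / 3)) : ℝ) = 2 * m + 1 := by
    rw [Fintype.card_fin]
    exact_mod_cast hb
  have hs : √(17 * ((3 * m : ℕ) : ℝ) ^ 2 + 24 * ((3 * m : ℕ) : ℝ)) =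
      3 * √(17 * (m : ℝ) ^ 2 + 8 * m) := by
    rw [show 17 * ((3 * m : ℕ) : ℝ) ^ 2 + 24 * ((3 * m : ℕ) : ℝ) =
      3 ^ 2 * (17 * (m : ℝ) ^ 2 + 8 * m) by push_cast; ring,
      Real.sqrt_mul (by norm_num), Real.sqrt_sq (by norm_num)]
  rw [sharpGraph, distSpecRad_graphJoin_top_bot ha' hb', hs,
    show ((m : ℝ) - 1 - 2 * (2 * m + 1) + 1) ^ 2 + 4 * (m - 1) * (2 * m + 1) =
      17 * (m : ℝ) ^ 2 + 8 * m by ring]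
  push_cast
  ring
end

section
/- Let k ≥ 4 and n ≥ k + 2 be integers. Then the distance spectral radius λ₁(D(K₁ ∨ (K_{n-k-1} ∪ kK₁))) is a root of the cubic polynomial g(x) = x³ − (n + k − 4)x² − ((2k+3)n − 2k² − 2k − 5)x − (k+2)n + k² + 2k + 2, and indeed it is the largest real root of g. -/
section

open scoped Matrix

theorem starGraph_adj (n k : ℕ) (u v : Fin 1 ⊕ (Fin (n - k - 1) ⊕ Fin k)) :
    (starGraph n k).Adj u v ↔ u ≠ v ∧ (u.isLeft ∨ v.isLeft ∨
      (∃ i j, u = .inr (.inl i) ∧ v = .inr (.inl j))) := by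
  rcases u with u | u | u <;> rcases v with v | v | v <;>
    simp [starGraph, graphJoin, graphDisjUnion, eq_iff_true_of_subsingleton]
  grind

/-- Distances in `starGraph n k`: distinct nonadjacent vertices have the cone vertex as a
common neighbour. -/
theorem starGraph_dist (n k : ℕ) (u v : Fin 1 ⊕ (Fin (n - k - 1) ⊕ Fin k)) [Decidable (u = v)]
    [Decidable ((starGraph n k).Adj u v)] :
    (starGraph n k).dist u v = if u = v then 0 else if (starGraph n k).Adj u v then 1 else 2 := by
  split_ifs with h h'
  · simp [h]
  · exact SimpleGraph.dist_eq_one_iff_adj.2 h'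
  · have hl : ¬ (u.isLeft ∨ v.isLeft) := fun hh => h' ((starGraph_adj ..).2 ⟨h, by tauto⟩)
    have hu : (starGraph n k).Adj u (.inl 0) := (starGraph_adj ..).2 ⟨by
      rintro rfl; simp at hl, by simp⟩
    have hv : (starGraph n k).Adj (.inl 0) v := (starGraph_adj ..).2 ⟨by
      rintro rfl; simp at hl, by simp⟩
    have hle := SimpleGraph.dist_le (SimpleGraph.Walk.cons hu (SimpleGraph.Walk.cons hv .nil))
    have h1 : (starGraph n k).dist u v ≠ 1 := fun e => h' (SimpleGraph.dist_eq_one_iff_adj.1 e)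
    have h0 : (starGraph n k).dist u v ≠ 0 := fun e =>
      h ((SimpleGraph.Reachable.dist_eq_zero_iff (hu.reachable.trans hv.reachable)).1 e)
    simp at hle
    omega

theorem sum_ite_ne_mul {ι : Type*} [Fintype ι] [DecidableEq ι] (c : ℝ) (f : ι → ℝ) (i : ι) :
    ∑ j, (if i = j then 0 else c) * f j = c * ∑ j, f j - c * f i := by
  have h (j : ι) : (if i = j then 0 else c) * f j = c * f j - if i = j then c * f j else 0 := by
    split_ifs <;> simp
  simp [h, Finset.sum_sub_distrib, Finset.mul_sum]

theorem distMatrix_starGraph_mulVec (n k : ℕ) (w : Fin 1 ⊕ (Fin (n - k - 1) ⊕ Fin k) → ℝ) :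
    distMatrix (starGraph n k) *ᵥ w = Sum.elim
      (fun _ => ∑ i, w (.inr (.inl i)) + ∑ j, w (.inr (.inr j)))
      (Sum.elim
        (fun i => w (.inl 0) + (∑ i, w (.inr (.inl i)) - w (.inr (.inl i)))
          + 2 * ∑ j, w (.inr (.inr j)))
        (fun j => w (.inl 0) + 2 * ∑ i, w (.inr (.inl i))
          + (2 * ∑ j, w (.inr (.inr j)) - 2 * w (.inr (.inr j))))) := by
  classical
  funext u
  rcases u with u | u | u
  · simp [Matrix.mulVec, dotProduct, distMatrix, starGraph_dist, starGraph_adj,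
      Subsingleton.elim u 0]
  · have h (a : ℝ) (j) : (if u = j then 0 else if u = j then 2 * a else a) =
        if u = j then 0 else a := by
      split_ifs <;> rfl
    have := sum_ite_ne_mul 1 (fun i => w (.inr (.inl i))) u
    simp [Matrix.mulVec, dotProduct, distMatrix, starGraph_dist, starGraph_adj, Finset.mul_sum,
      h] at this ⊢
    linarith
  · have := sum_ite_ne_mul 2 (fun i => w (.inr (.inr i))) u
    simp [Matrix.mulVec, dotProduct, distMatrix, starGraph_dist, starGraph_adj,
      ← Finset.mul_sum] at this ⊢
    linarith

theorem mem_spectrum_iff_exists_mulVec {ι : Type*} [Fintype ι] [DecidableEq ι]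
    (A : Matrix ι ι ℝ) (x : ℝ) : x ∈ spectrum ℝ A ↔ ∃ w ≠ 0, A *ᵥ w = x • w := by
  rw [← Matrix.spectrum_toLin', ← Module.End.hasEigenvalue_iff_mem_spectrum]
  constructor
  · intro h
    obtain ⟨w, hw⟩ := h.exists_hasEigenvector
    exact ⟨w, hw.2, by simpa using hw.apply_eq_smul⟩
  · rintro ⟨w, hw, h⟩
    exact Module.End.hasEigenvalue_of_hasEigenvector
      (x := w) (μ := x) ⟨Module.End.mem_eigenspace_iff.2 (by simpa using h), hw⟩

/-- The linear system satisfied by the class sums of an eigenvector of the distance matrix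
of `K₁ ∨ (K_m ∪ kK₁)` with eigenvalue `x`. -/
def classSumMatrix (m k x : ℝ) : Matrix (Fin 3) (Fin 3) ℝ :=
  !![x, -1, -1; -m, x + 1 - m, -2 * m; -k, -2 * k, x + 2 - 2 * k]

theorem det_classSumMatrix (m k x : ℝ) : (classSumMatrix m k x).det =
    x ^ 3 - (m + 2 * k - 3) * x ^ 2 + (2 - 3 * k - 3 * m - 2 * m * k) * x
      - (k + 2) * m - k := by
  simp [classSumMatrix, Matrix.det_fin_three]
  ring

theorem classSumMatrix_mulVec_eq_zero_iff (m k x : ℝ) (s : Fin 3 → ℝ) :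
    classSumMatrix m k x *ᵥ s = 0 ↔ x * s 0 = s 1 + s 2 ∧
      (x + 1) * s 1 = m * (s 0 + s 1 + 2 * s 2) ∧
      (x + 2) * s 2 = k * (s 0 + 2 * s 1 + 2 * s 2) := by
  simp only [classSumMatrix, funext_iff, Fin.forall_fin_succ, Matrix.mulVec, dotProduct,
    Fin.sum_univ_three]
  simp
  constructor
  · rintro ⟨h0, h1, h2⟩
    refine ⟨?_, ?_, ?_⟩ <;> linarith
  · rintro ⟨h0, h1, h2⟩
    refine ⟨?_, ?_, ?_⟩ <;> linarith

theorem det_eq_zero_of_mem_spectrum {n k : ℕ} {x : ℝ} (h1 : x ≠ -1) (h2 : x ≠ -2)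
    (hx : x ∈ spectrum ℝ (distMatrix (starGraph n k))) :
    (classSumMatrix (n - k - 1 : ℕ) k x).det = 0 := by
  obtain ⟨w, hw, h⟩ := (mem_spectrum_iff_exists_mulVec _ _).1 hx
  rw [distMatrix_starGraph_mulVec] at h
  set B := ∑ i, w (.inr (.inl i)) with hB
  set C := ∑ j, w (.inr (.inr j)) with hC
  have ha := congrFun h (.inl 0)
  have hb i := congrFun h (.inr (.inl i))
  have hc j := congrFun h (.inr (.inr j))
  simp only [Sum.elim_inl, Sum.elim_inr, Pi.smul_apply, smul_eq_mul] at ha hb hc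
  refine Matrix.exists_mulVec_eq_zero_iff.1 ⟨![w (.inl 0), B, C], fun hs => hw ?_, ?_⟩
  · have e0 : w (.inl 0) = 0 := by simpa using congrFun hs 0
    have e1 : B = 0 := by simpa using congrFun hs 1
    have e2 : C = 0 := by simpa using congrFun hs 2
    funext u
    rcases u with u | i | j
    · rw [Subsingleton.elim u 0, e0]; rfl
    · have := hb i
      rw [e0, e1, e2] at this
      have : (x + 1) * w (.inr (.inl i)) = 0 := by linarith
      exact (mul_eq_zero.1 this).resolve_left fun e => h1 (by linarith)
    · have := hc j
      rw [e0, e1, e2] at this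
      have : (x + 2) * w (.inr (.inr j)) = 0 := by linarith
      exact (mul_eq_zero.1 this).resolve_left fun e => h2 (by linarith)
  · rw [classSumMatrix_mulVec_eq_zero_iff]
    refine ⟨ha.symm, ?_, ?_⟩
    · have : ∑ i, (x + 1) * w (.inr (.inl i)) =
          ∑ i : Fin (n - k - 1), (w (.inl 0) + B + 2 * C) :=
        Finset.sum_congr rfl fun i _ => by linarith [hb i]
      rw [← Finset.mul_sum, ← hB] at this
      rwa [Finset.sum_const, Finset.card_univ, Fintype.card_fin, nsmul_eq_mul] at this
    · have : ∑ j, (x + 2) * w (.inr (.inr j)) = ∑ j : Fin k, (w (.inl 0) + 2 * B + 2 * C) :=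
        Finset.sum_congr rfl fun j _ => by linarith [hc j]
      rw [← Finset.mul_sum, ← hC] at this
      rwa [Finset.sum_const, Finset.card_univ, Fintype.card_fin, nsmul_eq_mul] at this

theorem mem_spectrum_of_det_eq_zero {n k : ℕ} {x : ℝ} (hm : n - k - 1 ≠ 0) (hk : k ≠ 0)
    (hx : (classSumMatrix (n - k - 1 : ℕ) k x).det = 0) :
    x ∈ spectrum ℝ (distMatrix (starGraph n k)) := by
  obtain ⟨s, hs, h⟩ := Matrix.exists_mulVec_eq_zero_iff.2 hx
  obtain ⟨h0, h1, h2⟩ := (classSumMatrix_mulVec_eq_zero_iff _ _ _ _).1 h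
  have hm' : ((n - k - 1 : ℕ) : ℝ) ≠ 0 := by exact_mod_cast hm
  have hk' : (k : ℝ) ≠ 0 := by exact_mod_cast hk
  refine (mem_spectrum_iff_exists_mulVec _ _).2
    ⟨Sum.elim (fun _ => s 0) (Sum.elim (fun _ => s 1 / (n - k - 1 : ℕ)) (fun _ => s 2 / k)),
      fun hw => hs ?_, ?_⟩
  · have e0 := congrFun hw (.inl 0)
    have e1 := congrFun hw (.inr (.inl ⟨0, by omega⟩))
    have e2 := congrFun hw (.inr (.inr ⟨0, by omega⟩))
    simp [hm', hk'] at e0 e1 e2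
    funext i
    fin_cases i <;> simp [e0, e1, e2]
  · rw [distMatrix_starGraph_mulVec]
    funext u
    rcases u with u | u | u
    · simp
      field_simp
      linarith
    · simp
      field_simp
      linarith
    · simp
      field_simp
      linarith

theorem exists_pos_det_classSumMatrix_eq_zero {m k : ℝ} (hm : 0 ≤ m) (hk : 0 < k) :
    ∃ x, 0 < x ∧ (classSumMatrix m k x).det = 0 := by
  set y : ℝ := 3 * m + 3 * k + 2 with hy
  have h0 : (classSumMatrix m k 0).det < 0 := by
    rw [det_classSumMatrix]; nlinarith [mul_nonneg hk.le hm]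
  have h1 : 0 ≤ (classSumMatrix m k y).det := by
    rw [det_classSumMatrix, hy]; ring_nf; positivity
  have hc : Continuous fun x => (classSumMatrix m k x).det := by
    simp only [det_classSumMatrix]; fun_prop
  obtain ⟨x, hx, h⟩ := intermediate_value_Icc (show (0 : ℝ) ≤ y by positivity) hc.continuousOn
    ⟨h0.le, h1⟩
  refine ⟨x, lt_of_le_of_ne hx.1 ?_, h⟩
  rintro rfl
  exact h0.ne h

end

/-- For `k ≥ 4` and `n ≥ k + 2`, the distance spectral radius
`λ₁(D(K₁ ∨ (K_{n-k-1} ∪ kK₁)))` is the largest real root of the cubic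
`g(x) = x³ − (n+k−4)x² − ((2k+3)n − 2k² − 2k − 5)x − (k+2)n + k² + 2k + 2`. -/
theorem distSpecRad_starGraph_isGreatest_root (k n : ℕ) (hk : 4 ≤ k) (hn : k + 2 ≤ n) :
    IsGreatest
      {x : ℝ | x ^ 3 - ((n : ℝ) + (k : ℝ) - 4) * x ^ 2
        - ((2 * (k : ℝ) + 3) * (n : ℝ) - 2 * (k : ℝ) ^ 2 - 2 * (k : ℝ) - 5) * x
        - ((k : ℝ) + 2) * (n : ℝ) + (k : ℝ) ^ 2 + 2 * (k : ℝ) + 2 = 0}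
      (distSpecRad (starGraph n k)) := by
  have hm : ((n - k - 1 : ℕ) : ℝ) = n - k - 1 := by
    rw [Nat.cast_sub (by omega), Nat.cast_sub (by omega)]; simp
  have hdet (x : ℝ) : x ^ 3 - ((n : ℝ) + (k : ℝ) - 4) * x ^ 2
      - ((2 * (k : ℝ) + 3) * (n : ℝ) - 2 * (k : ℝ) ^ 2 - 2 * (k : ℝ) - 5) * x
      - ((k : ℝ) + 2) * (n : ℝ) + (k : ℝ) ^ 2 + 2 * (k : ℝ) + 2
      = (classSumMatrix (n - k - 1 : ℕ) k x).det := by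
    rw [det_classSumMatrix, hm]; ring
  simp only [hdet]
  have hroot {x : ℝ} (hx : (classSumMatrix (n - k - 1 : ℕ) k x).det = 0) :=
    mem_spectrum_of_det_eq_zero (n := n) (by omega) (by omega) hx
  have hfin : (spectrum ℝ (distMatrix (starGraph n k))).Finite := Matrix.finite_real_spectrum
  obtain ⟨r, hr, hdr⟩ := exists_pos_det_classSumMatrix_eq_zero
    (m := (n - k - 1 : ℕ)) (k := k) (by positivity) (by positivity)
  have hle {x : ℝ} (hx : x ∈ spectrum ℝ (distMatrix (starGraph n k))) :
      x ≤ distSpecRad (starGraph n k) := le_csSup hfin.bddAbove hx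
  have hpos := hr.trans_le (hle (hroot hdr))
  exact ⟨det_eq_zero_of_mem_spectrum (by linarith) (by linarith)
    (Set.Nonempty.csSup_mem ⟨r, hroot hdr⟩ hfin), fun x hx => hle (hroot hx)⟩
end
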